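/- The material part (incarnation) of a design in a behaviour is the union of its normalization traces: for a behaviour A and a design D ∈ A, the minimal design of A included in D equals the union over all R ∈ A⊥ of the set of chronicles of D visited during normalization of (D, R), i.e. |D|_A = ⋃_{R ∈ A⊥} ⟦D ← R⟧. -/

import Mathlib

namespace Ludics

abbrev Address := List ℕ

/-- An action of Ludics: the daimon, or a proper action given by a polarity
(`true` = positive), a focus address and a ramification. -/
inductive Action where
  | daimon : Action
  | proper (pos : Bool) (focus : Address) (ram : Finset ℕ) : Action
deriving DecidableEq

namespace Action

def isPositive : Action → Bool
  | daimon => true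
  | proper pos _ _ => pos

def focus? : Action → Option Address
  | daimon => none
  | proper _ ξ _ => some ξ

/-- Reverse the polarity of an action. -/
def dual : Action → Action
  | daimon => daimon
  | proper pos ξ I => proper (!pos) ξ I

/-- `a.justifiesB b` : the focus of `b` is one of the addresses created by `a`. -/
def justifiesB : Action → Action → Bool
  | proper _ ξ I, proper _ ζ _ => decide (∃ i ∈ I, ζ = ξ ++ [i])
  | _, _ => false

def justifies (a b : Action) : Prop := a.justifiesB b = true

end Action

/-- A sequent of a base: an optional left address (at most one) and a finite
set of right addresses. -/
structure Sequent where
  left : Option Address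
  right : Finset Address

abbrev Base := List Sequent

def Base.isPositive (β : Base) : Prop := ∃ σ ∈ β, σ.left = none

/-- An action is initial w.r.t. a base if its focus belongs to the base
(on the side corresponding to its polarity). -/
def Initial (β : Base) (a : Action) : Prop :=
  ∃ pol ξ I, a = .proper pol ξ I ∧
    ∃ σ ∈ β, (pol = true ∧ ξ ∈ σ.right) ∨ (pol = false ∧ σ.left = some ξ)

/-- A sequent "owns" an action when its focus is hereditarily justified by an
address of the sequent (i.e. extends an address of the sequent). -/
def Sequent.owns (σ : Sequent) (a : Action) : Prop :=
  ∃ ξ, a.focus? = some ξ ∧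
    ((∃ γ, σ.left = some γ ∧ γ <+: ξ) ∨ (∃ δ ∈ σ.right, δ <+: ξ))

def Sequent.addresses (σ : Sequent) : Set Address :=
  (match σ.left with | some γ => {γ} | none => ∅) ∪ ↑σ.right

def Base.addresses (β : Base) : Set Address :=
  {a | ∃ σ ∈ β, a ∈ σ.addresses}

/-- The dual base: each sequent `Γ ⊢ Δ` gives sequents `⊢ Γ` and `δ ⊢` for δ ∈ Δ. -/
noncomputable def Sequent.dualSequents (σ : Sequent) : List Sequent :=
  (match σ.left with
    | some γ => [⟨none, ({γ} : Finset Address)⟩]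
    | none => []) ++
    σ.right.toList.map fun δ => ⟨some δ, (∅ : Finset Address)⟩

noncomputable def Base.dual (β : Base) : Base := (β.map Sequent.dualSequents).flatten

/-- View of a sequence, computed on the reversed sequence (most recent action
first), with fuel. -/
def viewRevAux : ℕ → List Action → List Action
  | 0, _ => []
  | _ + 1, [] => []
  | n + 1, a :: w =>
    if a.isPositive then a :: viewRevAux n w
    else a :: viewRevAux n (w.dropWhile fun b => !(b.justifiesB a))

def viewRev (s : List Action) : List Action := viewRevAux s.length s

/-- The view `⌜s⌝` of a sequence of actions. -/
def view (s : List Action) : List Action := (viewRev s.reverse).reverse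

/-- `p` is a path based on `β`. -/
structure IsPath (β : Base) (p : List Action) : Prop where
  alternating : p.Chain' fun a b => a.isPositive ≠ b.isPositive
  justified : ∀ w a, w ++ [a] <+: p → a ≠ Action.daimon →
    Initial β a ∨ ∃ b ∈ w, b.justifies a
  negJump : ∀ w a b, w ++ [a] <+: p → a.isPositive = true → b ∈ w →
    b.justifies a → b ∈ view w
  posJump : ∀ w a, w ++ [a] <+: p → a.isPositive = true → a ≠ Action.daimon →
    ∀ σ ∈ β, (∃ f, a.focus? = some f ∧ f ∈ σ.right) →
      (w = [] ∧ σ.left = none) ∨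
      ∃ w' b, w = w' ++ [b] ∧ b.isPositive = false ∧ σ.owns b
  linearity : (p.filterMap Action.focus?).Nodup
  daimonLast : ∀ w, w ++ [Action.daimon] <+: p → w ++ [Action.daimon] = p
  daimonFirst : p.head? = some Action.daimon → β.isPositive
  totality : β.isPositive → ∃ a t, p = a :: t ∧
    (a = Action.daimon ∨ (a.isPositive = true ∧ Initial β a))

/-- A chronicle: a non-empty path where each non-initial negative action is
justified by the immediately preceding action. -/
def IsChronicle (β : Base) (c : List Action) : Prop :=
  IsPath β c ∧ c ≠ [] ∧
    ∀ w a b, w ++ [a, b] <+: c → b.isPositive = false →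
      Initial β b ∨ a.justifies b

/-- The dual of a positive-ended sequence: reverse all polarities, removing a
final daimon if present and appending one otherwise. -/
def dualSeq (p : List Action) : List Action :=
  if p.getLast? = some Action.daimon then p.dropLast.map Action.dual
  else p.map Action.dual ++ [Action.daimon]

/-- Positive-ended (possibly empty) sequence. -/
def PosEnded (p : List Action) : Prop :=
  p = [] ∨ ∃ a, p.getLast? = some a ∧ a.isPositive = true

/-- A (non-empty) negative-starting, positive-ended block. -/
def NegBlock (b : List Action) : Prop :=
  b ≠ [] ∧ (∀ a, b.head? = some a → a.isPositive = false) ∧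
    ∀ a, b.getLast? = some a → a.isPositive = true

def EndsWithDaimon (p : List Action) : Prop := p.getLast? = some Action.daimon

/-- Basic shuffle of two positive-ended negative paths: interleaving by
positive-ended negative blocks; if the last `p`-block ends with the daimon
then the last `q`-block is empty. -/
def ShuffleNeg (p q r : List Action) : Prop :=
  ∃ ps qs : List (List Action),
    ps.length = qs.length ∧
    (∀ b ∈ ps, b = [] ∨ NegBlock b) ∧
    (∀ b ∈ qs, b = [] ∨ NegBlock b) ∧
    ps.flatten = p ∧ qs.flatten = q ∧
    (List.zipWith (· ++ ·) ps qs).flatten = r ∧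
    (EndsWithDaimon (ps.getLast?.getD []) → qs.getLast?.getD [] = [])

/-- The shuffle `r ∈ p ⧢ q`, including the extensions to two daimon-ended
paths and to paths with a common positive-ended prefix. -/
inductive Shuffle : List Action → List Action → List Action → Prop where
  | base {p q r} : ShuffleNeg p q r → Shuffle p q r
  | daiLeft {p q r} {κ₁ κ₂ : Action} :
      Shuffle (p ++ [κ₁, Action.daimon]) q r →
      Shuffle (p ++ [κ₁, Action.daimon]) (q ++ [κ₂, Action.daimon]) r
  | daiRight {p q r} {κ₁ κ₂ : Action} :
      Shuffle p (q ++ [κ₂, Action.daimon]) r →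
      Shuffle (p ++ [κ₁, Action.daimon]) (q ++ [κ₂, Action.daimon]) r
  | pre {s p q r} : s ≠ [] → PosEnded s → Shuffle p q r →
      Shuffle (s ++ p) (s ++ q) (s ++ r)

/-- Shuffle closure of a set of (positive-ended) paths. -/
inductive ShuffleClosure (P : Set (List Action)) : List Action → Prop where
  | mem {p} : p ∈ P → ShuffleClosure P p
  | shuffle {p q r} : ShuffleClosure P p → ShuffleClosure P q →
      Shuffle p q r → ShuffleClosure P r

/-- Coherence of chronicles: comparability and propagation. -/
def Coherent (c₁ c₂ : List Action) : Prop :=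
  (∀ w κ₁ κ₂, w ++ [κ₁] <+: c₁ → w ++ [κ₂] <+: c₂ →
      κ₁ = κ₂ ∨ (κ₁.isPositive = false ∧ κ₂.isPositive = false)) ∧
  (∀ w ξ₁ I₁ w₁ σ₁ ξ₂ I₂ w₂ σ₂,
      w ++ Action.proper false ξ₁ I₁ :: w₁ ++ [σ₁] <+: c₁ →
      w ++ Action.proper false ξ₂ I₂ :: w₂ ++ [σ₂] <+: c₂ →
      ξ₁ ≠ ξ₂ → ∀ f, σ₁.focus? = some f → σ₂.focus? ≠ some f)

/-- A design, as a prefix-closed clique of chronicles. -/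
structure IsDesign (β : Base) (D : Set (List Action)) : Prop where
  chron : ∀ c ∈ D, IsChronicle β c
  prefixClosed : ∀ c ∈ D, ∀ d, d <+: c → d ≠ [] → d ∈ D
  coherent : ∀ c ∈ D, ∀ d ∈ D, Coherent c d
  maxPos : ∀ c ∈ D, (∀ κ, c ++ [κ] ∉ D) →
    ∃ a, c.getLast? = some a ∧ a.isPositive = true
  posNonempty : β.isPositive → D.Nonempty

/-- A net of designs, abusively seen as its set of chronicles. -/
structure IsNet (β : Base) (R : Set (List Action)) : Prop where
  chron : ∀ c ∈ R, IsChronicle β c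
  prefixClosed : ∀ c ∈ R, ∀ d, d <+: c → d ≠ [] → d ∈ R

/-- `p` is a path of the design/net `D`: each view of each non-empty prefix of
`p` is a chronicle of `D`. -/
def PathOf (β : Base) (D : Set (List Action)) (p : List Action) : Prop :=
  IsPath β p ∧ ∀ q, q <+: p → q ≠ [] → view q ∈ D

/-- Whose turn it is in normalization: `dpos` says whether the design `D` owns
the first (positive) move; afterwards `D` moves exactly after negative actions. -/
def TurnD (dpos : Prop) (s : List Action) : Prop :=
  match s.getLast? with
  | none => dpos
  | some a => a.isPositive = false

/-- Interaction (normalization) between a design `D` and a counter-net `R`,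
described by its visited sequence `s` (seen from `D`): it converges from
state `s` if the design to move plays the daimon, or it plays a proper
positive action accepted (in dual form) by the other one, and the interaction
converges from the extended state. -/
inductive Conv (D R : Set (List Action)) (dpos : Prop) : List Action → Prop where
  | daiD {s} : TurnD dpos s → view (s ++ [Action.daimon]) ∈ D → Conv D R dpos s
  | daiR {s} : ¬ TurnD dpos s →
      view (s.map Action.dual ++ [Action.daimon]) ∈ R → Conv D R dpos s
  | stepD {s κ} : TurnD dpos s → κ.isPositive = true → κ ≠ Action.daimon →
      view (s ++ [κ]) ∈ D → view ((s ++ [κ]).map Action.dual) ∈ R →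
      Conv D R dpos (s ++ [κ]) → Conv D R dpos s
  | stepR {s κ} : ¬ TurnD dpos s → κ.isPositive = false →
      view ((s ++ [κ]).map Action.dual) ∈ R → view (s ++ [κ]) ∈ D →
      Conv D R dpos (s ++ [κ]) → Conv D R dpos s

/-- The simple base `⊢ ξ` (positive) or `ξ ⊢` (negative). -/
def simpleBase (ξ : Address) (pos : Bool) : Base :=
  if pos then [⟨none, {ξ}⟩] else [⟨some ξ, ∅⟩]

/-- The orthogonal of a set of designs on a simple base. -/
def orthSet (ξ : Address) (pos : Bool) (A : Set (Set (List Action))) :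
    Set (Set (List Action)) :=
  {E | IsDesign (simpleBase ξ !pos) E ∧
    ∀ D ∈ A, if pos then Conv D E True [] else Conv E D True []}

def biorth (ξ : Address) (pos : Bool) (A : Set (Set (List Action))) :
    Set (Set (List Action)) :=
  orthSet ξ (!pos) (orthSet ξ pos A)

/-- A behaviour: a bi-orthogonally closed set of designs on a simple base. -/
structure Behaviour (ξ : Address) (pos : Bool) where
  designs : Set (Set (List Action))
  isDesign : ∀ D ∈ designs, IsDesign (simpleBase ξ pos) D
  closed : designs = biorth ξ pos designs

/-- Visitable paths of a set of designs: traces of convergent normalizations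
with the orthogonal, characterized as the dual pairs of paths. -/
def VisitableSet (ξ : Address) (pos : Bool) (S : Set (Set (List Action)))
    (p : List Action) : Prop :=
  ∃ D ∈ S, ∃ E ∈ orthSet ξ pos S,
    PathOf (simpleBase ξ pos) D p ∧ PathOf (simpleBase ξ !pos) E (dualSeq p)

def Visitable {ξ : Address} {pos : Bool} (A : Behaviour ξ pos)
    (p : List Action) : Prop :=
  VisitableSet ξ pos A.designs p

/-- Material (incarnated) design of a behaviour: inclusion-minimal. -/
def Material {ξ : Address} {pos : Bool} (A : Behaviour ξ pos)
    (D : Set (List Action)) : Prop :=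
  D ∈ A.designs ∧ ∀ E ∈ A.designs, E ⊆ D → E = D

/-- Completion of a design: add daimon-ended chronicles after every missing
negative action. -/
def completion (β : Base) (D : Set (List Action)) : Set (List Action) :=
  D ∪ {c' | ∃ c ∈ D, ∃ ξ I,
    (c' = c ++ [Action.proper false ξ I] ∨
      c' = c ++ [Action.proper false ξ I, Action.daimon]) ∧
    IsChronicle β (c ++ [Action.proper false ξ I, Action.daimon]) ∧
    c ++ [Action.proper false ξ I] ∉ D}

def DaiDesign : Set (List Action) := {[Action.daimon]}

def firstAction (D : Set (List Action)) (κ : Action) : Prop :=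
  ∃ c ∈ D, c.head? = some κ

/-- Directory of a set of positive designs on `⊢ ξ`. -/
def directory (ξ : Address) (A : Set (Set (List Action))) : Set (Finset ℕ) :=
  {I | ∃ D ∈ A, firstAction D (Action.proper true ξ I)}

/-- Alien positive behaviours: ramifications of first actions pairwise disjoint. -/
def Alien (ξ : Address) (A B : Behaviour ξ true) : Prop :=
  ∀ I ∈ directory ξ A.designs, ∀ J ∈ directory ξ B.designs, Disjoint I J

/-- Extension of the first action of a design by a set `J`. -/
def extDesign (ξ : Address) (J : Finset ℕ) (D : Set (List Action)) :
    Set (List Action) :=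
  {c | ∃ I t, (Action.proper true ξ I :: t) ∈ D ∧
      c = Action.proper true ξ (I ∪ J) :: t}

/-- The extension `A_[B]` of a set of designs along another. -/
def extended (ξ : Address) (A B : Set (Set (List Action))) :
    Set (Set (List Action)) :=
  insert DaiDesign
    {D' | ∃ D ∈ A, (∃ I, firstAction D (Action.proper true ξ I)) ∧
      ∃ E ∈ B, ∃ J, firstAction E (Action.proper true ξ J) ∧
        D' = extDesign ξ J D}

/-- The extension `P_[Q]` of a set of paths along another. -/
def extPaths (ξ : Address) (P Q : Set (List Action)) : Set (List Action) :=
  insert [Action.daimon]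
    {p | ∃ I t, (Action.proper true ξ I :: t) ∈ P ∧
      ∃ q ∈ Q, ∃ J, q.head? = some (Action.proper true ξ J) ∧
        p = Action.proper true ξ (I ∪ J) :: t}

/-- Prefixing a (negative) design by the positive action `(+, ξ, {i})`. -/
def shiftD (ξ : Address) (i : ℕ) (D : Set (List Action)) : Set (List Action) :=
  insert [Action.proper true ξ {i}]
    {c | ∃ d ∈ D, c = Action.proper true ξ {i} :: d}

/-- `C = ↑N` : the positive shift of the negative behaviour `N`. -/
def IsShiftOf (ξ : Address) (i : ℕ) (C : Behaviour ξ true)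
    (N : Behaviour (ξ ++ [i]) false) : Prop :=
  C.designs = biorth ξ true (shiftD ξ i '' N.designs)

/-- `C = ⊕ₖ F k`. -/
def IsSumOf {ξ : Address} {ι : Type} (C : Behaviour ξ true)
    (F : ι → Behaviour ξ true) : Prop :=
  C.designs = biorth ξ true (⋃ k, (F k).designs)

/-- Pairwise disjoint family of positive behaviours (disjoint directories). -/
def PairwiseDisjointFam {ξ : Address} {ι : Type}
    (F : ι → Behaviour ξ true) : Prop :=
  ∀ k l, k ≠ l → ∀ I ∈ directory ξ (F k).designs,
    I ∉ directory ξ (F l).designs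

open Classical in
/-- Tensor of two positive designs on `⊢ ξ`. -/
noncomputable def tensorD (ξ : Address) (D E : Set (List Action)) :
    Set (List Action) :=
  if D = DaiDesign ∨ E = DaiDesign then DaiDesign
  else {c | ∃ I J, firstAction D (Action.proper true ξ I) ∧
      firstAction E (Action.proper true ξ J) ∧
      ∃ t, ((Action.proper true ξ I :: t) ∈ D ∨
            (Action.proper true ξ J :: t) ∈ E) ∧
        c = Action.proper true ξ (I ∪ J) :: t}

/-- `C = A ⊗ B`. -/
def IsTensorOf {ξ : Address} (C A B : Behaviour ξ true) : Prop :=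
  C.designs = biorth ξ true
    {G | ∃ D ∈ A.designs, ∃ E ∈ B.designs, G = tensorD ξ D E}

/-- Hereditary chains of justifiers inside a sequence `p`. -/
inductive JustChain (β : Base) (p : List Action) : List Action → Prop where
  | init {κ} : κ ∈ p → Initial β κ → JustChain β p [κ]
  | cons {s κ κ'} : JustChain β p (s ++ [κ]) → κ' ∈ p → κ.justifies κ' →
      JustChain β p (s ++ [κ, κ'])

/-- Trivial chronicle for a behaviour: hereditary-justifier sequence of an
action of a chronicle of a material design. -/
def TrivialChronicle {ξ : Address} {pos : Bool} (A : Behaviour ξ pos)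
    (s : List Action) : Prop :=
  ∃ D, Material A D ∧ ∃ c ∈ D, JustChain (simpleBase ξ pos) c s

/-- Regular path for a behaviour: reversible path whose justifier chains are
trivial chronicles for the behaviour. -/
def RegularPath {ξ : Address} {pos : Bool} (A : Behaviour ξ pos)
    (p : List Action) : Prop :=
  IsPath (simpleBase ξ pos) p ∧ IsPath (simpleBase ξ !pos) (dualSeq p) ∧
  ∀ κ ∈ p, κ ≠ Action.daimon →
    ∃ s, JustChain (simpleBase ξ pos) p s ∧ s.getLast? = some κ ∧
      TrivialChronicle A s

/-- Regular behaviour: every regular path is visitable. -/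
def Regular {ξ : Address} {pos : Bool} (A : Behaviour ξ pos) : Prop :=
  ∀ p, RegularPath A p → Visitable A p

/-- Proper actions occurring in a design. -/
def properActs (D : Set (List Action)) : Set Action :=
  {a | a ≠ Action.daimon ∧ ∃ c ∈ D, a ∈ c}

/-- Essentially finite behaviour: finitely many material designs, all finite. -/
def EssFinite {ξ : Address} {pos : Bool} (A : Behaviour ξ pos) : Prop :=
  {D | Material A D}.Finite ∧ ∀ D, Material A D → (properActs D).Finite

/-- A slice of a design. -/
def IsSlice (D S : Set (List Action)) : Prop :=
  S ⊆ D ∧ (∀ c ∈ S, ∀ d, d <+: c → d ≠ [] → d ∈ S) ∧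
  ∀ w ξ I₁ I₂, w ++ [Action.proper false ξ I₁] ∈ S →
    w ++ [Action.proper false ξ I₂] ∈ S → I₁ = I₂

/-- Uniformly bounded behaviour: slice sizes of material designs uniformly
bounded. -/
def UnifBounded {ξ : Address} {pos : Bool} (A : Behaviour ξ pos) : Prop :=
  ∃ N : ℕ, ∀ D, Material A D → ∀ S, IsSlice D S →
    (properActs S).Finite ∧ (properActs S).ncard < N

def oneDesign (ξ : Address) : Set (List Action) :=
  {[Action.proper true ξ ∅]}

mutual
  /-- The class `C∞⁺` of positive behaviours: `0`, `1`, or a (possibly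
  infinite) nonempty sum of finite tensors of shifts of `C∞⁻` elements. -/
  inductive CInf : (ξ : Address) → Behaviour ξ true → Prop where
    | zero {ξ} (A : Behaviour ξ true) :
        A.designs = {DaiDesign} → CInf ξ A
    | one {ξ} (A : Behaviour ξ true) :
        A.designs = biorth ξ true {oneDesign ξ} → CInf ξ A
    | sum {ξ} {ι : Type} (F : ι → Behaviour ξ true) (C : Behaviour ξ true) :
        Nonempty ι → (∀ k, CInfTS ξ (F k)) → PairwiseDisjointFam F →
        IsSumOf C F → CInf ξ C
  /-- Finite tensors of positive shifts of duals of `C∞⁺` elements. -/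
  inductive CInfTS : (ξ : Address) → Behaviour ξ true → Prop where
    | shift {ξ} {i : ℕ} (C : Behaviour ξ true) (N : Behaviour (ξ ++ [i]) false)
        (P : Behaviour (ξ ++ [i]) true) :
        CInf (ξ ++ [i]) P → N.designs = orthSet (ξ ++ [i]) true P.designs →
        IsShiftOf ξ i C N → CInfTS ξ C
    | tensor {ξ} (A B C : Behaviour ξ true) :
        CInfTS ξ A → CInfTS ξ B → Alien ξ A B → IsTensorOf C A B →
        CInfTS ξ C
end

mutual
  /-- The class `C_f⁺`: as `C∞⁺` but with finite sums only. -/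
  inductive CFin : (ξ : Address) → Behaviour ξ true → Prop where
    | zero {ξ} (A : Behaviour ξ true) :
        A.designs = {DaiDesign} → CFin ξ A
    | one {ξ} (A : Behaviour ξ true) :
        A.designs = biorth ξ true {oneDesign ξ} → CFin ξ A
    | sum {ξ} {ι : Type} (F : ι → Behaviour ξ true) (C : Behaviour ξ true) :
        Nonempty ι → Finite ι → (∀ k, CFinTS ξ (F k)) → PairwiseDisjointFam F →
        IsSumOf C F → CFin ξ C
  inductive CFinTS : (ξ : Address) → Behaviour ξ true → Prop where
    | shift {ξ} {i : ℕ} (C : Behaviour ξ true) (N : Behaviour (ξ ++ [i]) false)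
        (P : Behaviour (ξ ++ [i]) true) :
        CFin (ξ ++ [i]) P → N.designs = orthSet (ξ ++ [i]) true P.designs →
        IsShiftOf ξ i C N → CFinTS ξ C
    | tensor {ξ} (A B C : Behaviour ξ true) :
        CFinTS ξ A → CFinTS ξ B → Alien ξ A B → IsTensorOf C A B →
        CFinTS ξ C
end

/-- The class `C∞⁻` : duals of `C∞⁺` elements. -/
def CInfN (ξ : Address) (B : Behaviour ξ false) : Prop :=
  ∃ A : Behaviour ξ true, CInf ξ A ∧ B.designs = orthSet ξ true A.designs

def CFinN (ξ : Address) (B : Behaviour ξ false) : Prop :=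
  ∃ A : Behaviour ξ true, CFin ξ A ∧ B.designs = orthSet ξ true A.designs

theorem viewRevAux_fuel : ∀ (n m : ℕ) (l : List Action), l.length ≤ n → l.length ≤ m →
    viewRevAux n l = viewRevAux m l := by
  intro n
  induction n with
  | zero =>
    intro m l h1 _
    have : l = [] := List.length_eq_zero_iff.mp (by omega)
    subst this
    cases m <;> rfl
  | succ n ih =>
    intro m l h1 h2
    cases l with
    | nil => cases m <;> rfl
    | cons a w =>
      cases m with
      | zero => simp at h2
      | succ m =>
        simp only [List.length_cons] at h1 h2
        have hl := (List.dropWhile_suffix (l := w) (fun b => !(b.justifiesB a))).length_le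
        simp only [viewRevAux]
        rw [ih m w (by omega) (by omega),
          ih m (w.dropWhile fun b => !(b.justifiesB a)) (by omega) (by omega)]

theorem view_nil : view [] = [] := rfl

theorem view_snoc_pos (s : List Action) (a : Action) (h : a.isPositive = true) :
    view (s ++ [a]) = view s ++ [a] := by
  simp [view, viewRev, viewRevAux, h]

theorem view_snoc (s : List Action) (a : Action) :
    ∃ s', s' <+: s ∧ view (s ++ [a]) = view s' ++ [a] := by
  by_cases h : a.isPositive = true
  · exact ⟨s, List.prefix_rfl, view_snoc_pos s a h⟩
  · refine ⟨(s.reverse.dropWhile fun b => !(b.justifiesB a)).reverse, ?_, ?_⟩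
    · have := List.dropWhile_suffix (l := s.reverse) (fun b => !(b.justifiesB a))
      rw [← List.reverse_suffix, List.reverse_reverse]
      exact this
    · have hl := (List.dropWhile_suffix (l := s.reverse)
        (fun b => !(b.justifiesB a))).length_le
      simp only [view, viewRev, List.reverse_append, List.reverse_cons, List.reverse_nil,
        List.nil_append, List.singleton_append, List.length_cons, viewRevAux, h,
        List.reverse_reverse]
      simp only [Bool.false_eq_true, if_false, List.reverse_cons]
      rw [viewRevAux_fuel _ _ _ hl le_rfl]

theorem snoc_cases (s : List Action) : s = [] ∨ ∃ u a, s = u ++ [a] := by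
  rcases List.eq_nil_or_concat s with h | ⟨u, a, h⟩
  · exact Or.inl h
  · exact Or.inr ⟨u, a, by simpa using h⟩

theorem prefix_snoc {d u : List Action} {a : Action} (h : d <+: u ++ [a]) :
    d = u ++ [a] ∨ d <+: u := by
  simpa using (List.prefix_concat_iff (l₁ := d) (l₂ := u) (a := a)).mp (by simpa using h)

theorem view_prefix : ∀ (n : ℕ) (q d : List Action), q.length ≤ n → d <+: view q →
    ∃ q', q' <+: q ∧ d = view q' := by
  intro n
  induction n with
  | zero =>
    intro q d h1 h
    have : q = [] := List.length_eq_zero_iff.mp (by omega)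
    subst this
    rw [view_nil] at h
    exact ⟨[], List.prefix_rfl, by rw [view_nil]; exact List.prefix_nil.mp h⟩
  | succ n ih =>
    intro q d h1 h
    rcases snoc_cases q with rfl | ⟨u, a, rfl⟩
    · rw [view_nil] at h
      exact ⟨[], List.prefix_rfl, by rw [view_nil]; exact List.prefix_nil.mp h⟩
    · obtain ⟨s', hs', hv⟩ := view_snoc u a
      rw [hv] at h
      rcases prefix_snoc h with h | h
      · exact ⟨u ++ [a], List.prefix_rfl, by rw [h, hv]⟩
      · have := hs'.length_le
        simp only [List.length_append, List.length_singleton] at h1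
        obtain ⟨q', hq', e⟩ := ih s' d (by omega) h
        exact ⟨q', hq'.trans (hs'.trans (List.prefix_append _ _)), e⟩

theorem view_mem : ∀ (n : ℕ) (q : List Action), q.length ≤ n → ∀ x ∈ view q, x ∈ q := by
  intro n
  induction n with
  | zero =>
    intro q h1
    have : q = [] := List.length_eq_zero_iff.mp (by omega)
    subst this
    simp [view_nil]
  | succ n ih =>
    intro q h1 x hx
    rcases snoc_cases q with rfl | ⟨u, a, rfl⟩
    · simp [view_nil] at hx
    · obtain ⟨s', hs', hv⟩ := view_snoc u a
      rw [hv] at hx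
      have := hs'.length_le
      simp only [List.length_append, List.length_singleton] at h1
      rcases List.mem_append.mp hx with hx | hx
      · exact List.mem_append_left _ (hs'.subset (ih s' (by omega) x hx))
      · exact List.mem_append_right _ hx

theorem mem_of_view {q : List Action} {x : Action} (h : x ∈ view q) : x ∈ q :=
  view_mem _ q le_rfl x h

theorem dual_dual (a : Action) : a.dual.dual = a := by
  cases a <;> simp [Action.dual]

theorem map_dual_dual (s : List Action) : (s.map Action.dual).map Action.dual = s := by
  simp [Function.comp_def, dual_dual]

theorem dual_eq_daimon {a : Action} : a.dual = Action.daimon ↔ a = Action.daimon := by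
  cases a <;> simp [Action.dual]

theorem dual_isPositive {a : Action} (h : a ≠ Action.daimon) :
    a.dual.isPositive = !a.isPositive := by
  cases a <;> simp_all [Action.dual, Action.isPositive]

theorem dual_inj {a b : Action} (h : a.dual = b.dual) : a = b := by
  rw [← dual_dual a, h, dual_dual]

theorem focus_dual (a : Action) : a.dual.focus? = a.focus? := by
  cases a <;> rfl

theorem daimon_mem_map {s : List Action} :
    Action.daimon ∈ s.map Action.dual ↔ Action.daimon ∈ s := by
  simp [dual_eq_daimon]

theorem dualSeq_snoc (s : List Action) :
    dualSeq (s ++ [Action.daimon]) = s.map Action.dual := by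
  simp [dualSeq]

theorem dualSeq_nodai {s : List Action} (h : Action.daimon ∉ s) :
    dualSeq s = s.map Action.dual ++ [Action.daimon] := by
  unfold dualSeq
  rw [if_neg]
  intro h'
  exact h (List.mem_of_getLast? h')

theorem path_split {β : Base} {p : List Action} (h : IsPath β p) :
    ∃ s, Action.daimon ∉ s ∧ (p = s ∨ p = s ++ [Action.daimon]) := by
  by_cases hd : Action.daimon ∈ p
  · obtain ⟨w, t, rfl, hw⟩ := List.eq_append_cons_of_mem hd
    refine ⟨w, hw, Or.inr ?_⟩
    exact (h.daimonLast w ⟨t, by simp⟩).symm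
  · exact ⟨p, hd, Or.inl rfl⟩

theorem dualSeq_dualSeq {β : Base} {p : List Action} (h : IsPath β p) :
    dualSeq (dualSeq p) = p := by
  obtain ⟨s, hs, rfl | rfl⟩ := path_split h
  · rw [dualSeq_nodai hs, dualSeq_snoc, map_dual_dual]
  · rw [dualSeq_snoc, dualSeq_nodai (by rwa [daimon_mem_map]), map_dual_dual]

theorem base_pos_iff (ξ : Address) (b : Bool) :
    Base.isPositive (simpleBase ξ b) ↔ b = true := by
  cases b <;> simp [Base.isPositive, simpleBase]

theorem initial_iff (ξ : Address) (b : Bool) (a : Action) :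
    Initial (simpleBase ξ b) a ↔ ∃ I, a = .proper b ξ I := by
  cases b <;> simp [Initial, simpleBase]

theorem justifies_focus {a b : Action} (h : a.justifies b) :
    ∃ f i, a.focus? = some f ∧ b.focus? = some (f ++ [i]) := by
  cases a <;> cases b <;> simp [Action.justifies, Action.justifiesB, Action.focus?] at *
  obtain ⟨i, _, h⟩ := h
  exact ⟨i, h⟩

theorem alt_of {p : List Action}
    (h : p.IsChain fun a b => a.isPositive ≠ b.isPositive)
    {u : List Action} {a b : Action} (hp : u ++ [a] ++ [b] <+: p) :
    a.isPositive = !b.isPositive := by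
  obtain ⟨t, rfl⟩ := hp
  have : (u ++ ([a, b] ++ t)).IsChain fun a b => a.isPositive ≠ b.isPositive := by
    simpa using h
  have := (List.isChain_append.mp this).2.1
  simp at this
  revert this
  cases a.isPositive <;> cases b.isPositive <;> simp

theorem head_pol {ξ : Address} {b : Bool} {p : List Action} (h : IsPath (simpleBase ξ b) p)
    {a : Action} {t : List Action} (hp : p = a :: t) : a.isPositive = b := by
  subst hp
  cases b
  · have h1 : a ≠ Action.daimon := by
      intro e
      have := h.daimonFirst (by simp [e])
      simp [base_pos_iff] at this
    rcases h.justified [] a ⟨t, by simp⟩ h1 with h2 | ⟨_, h2, _⟩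
    · obtain ⟨I, rfl⟩ := (initial_iff _ _ _).mp h2
      rfl
    · simp at h2
  · obtain ⟨a', t', e, h2⟩ := h.totality ((base_pos_iff _ _).mpr rfl)
    simp only [List.cons.injEq] at e
    obtain ⟨rfl, rfl⟩ := e
    rcases h2 with rfl | h2
    · rfl
    · exact h2.1

theorem foc_disj {l1 l2 : List Action} (h : ((l1 ++ l2).filterMap Action.focus?).Nodup)
    {x y : Action} {f : Address} (hx : x ∈ l1) (hy : y ∈ l2) (fx : x.focus? = some f)
    (fy : y.focus? = some f) : False := by
  rw [List.filterMap_append] at h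
  exact (List.disjoint_of_nodup_append h) (List.mem_filterMap.mpr ⟨x, hx, fx⟩)
    (List.mem_filterMap.mpr ⟨y, hy, fy⟩)

theorem foc_inj : ∀ {s : List Action}, (s.filterMap Action.focus?).Nodup →
    ∀ {x y : Action} {f : Address}, x ∈ s → y ∈ s → x.focus? = some f →
    y.focus? = some f → x = y := by
  intro s
  induction s with
  | nil => intro _ x y f hx; simp at hx
  | cons a s ih =>
    intro h x y f hx hy fx fy
    have h' : (([a] ++ s).filterMap Action.focus?).Nodup := by simpa using h
    have hs : (s.filterMap Action.focus?).Nodup := by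
      rw [List.filterMap_append] at h'
      exact h'.of_append_right
    rcases List.mem_cons.mp hx with rfl | hx1
    · rcases List.mem_cons.mp hy with rfl | hy
      · rfl
      · exact (foc_disj h' (by simp) hy fx fy).elim
    · rcases List.mem_cons.mp hy with rfl | hy
      · exact (foc_disj h' (by simp) (by assumption) fy fx).elim
      · exact ih hs (by assumption) hy fx fy

theorem fork : ∀ (c c' : List Action), c <+: c' ∨ c' <+: c ∨
    ∃ w x y, x ≠ y ∧ w ++ [x] <+: c ∧ w ++ [y] <+: c' := by
  intro c
  induction c with
  | nil => intro c'; exact Or.inl (List.nil_prefix)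
  | cons a c ih =>
    intro c'
    cases c' with
    | nil => exact Or.inr (Or.inl List.nil_prefix)
    | cons b c' =>
      by_cases hab : a = b
      · subst hab
        rcases ih c' with h | h | ⟨w, x, y, h1, h2, h3⟩
        · exact Or.inl (by simpa using h)
        · exact Or.inr (Or.inl (by simpa using h))
        · exact Or.inr (Or.inr ⟨a :: w, x, y, h1, by simpa using h2, by simpa using h3⟩)
      · exact Or.inr (Or.inr ⟨[], a, b, hab, ⟨c, by simp⟩, ⟨c', by simp⟩⟩)

def Legal (ξ : Address) (b : Bool) (X Y : Set (List Action)) (s : List Action) : Prop :=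
  IsDesign (simpleBase ξ b) X ∧ IsDesign (simpleBase ξ !b) Y ∧ Action.daimon ∉ s ∧
    ∀ q, q <+: s → q ≠ [] → view q ∈ X ∧ view (q.map Action.dual) ∈ Y

theorem Legal.swap {ξ : Address} {b : Bool} {X Y : Set (List Action)} {s : List Action}
    (h : Legal ξ b X Y s) : Legal ξ (!b) Y X (s.map Action.dual) := by
  obtain ⟨h1, h2, h3, h4⟩ := h
  refine ⟨h2, by simpa using h1, by rwa [daimon_mem_map], ?_⟩
  intro q hq hne
  have hq' : q.map Action.dual <+: s := by
    have := hq.map Action.dual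
    rwa [map_dual_dual] at this
  have := h4 _ hq' (by simpa using hne)
  rw [map_dual_dual] at this
  exact ⟨this.2, this.1⟩

theorem Legal.pre {ξ : Address} {b : Bool} {X Y : Set (List Action)} {s u : List Action}
    (h : Legal ξ b X Y s) (hu : u <+: s) : Legal ξ b X Y u :=
  ⟨h.1, h.2.1, fun hd => h.2.2.1 (hu.subset hd), fun q hq => h.2.2.2 q (hq.trans hu)⟩

theorem neg_just {β : Base} {v : List Action} {κ : Action} (h : IsChronicle β (v ++ [κ]))
    (hκ : κ.isPositive = false) :
    Initial β κ ∨ ∃ v' a, v = v' ++ [a] ∧ a.justifies κ ∧ a.isPositive = true := by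
  rcases snoc_cases v with rfl | ⟨v', a, rfl⟩
  · have hd : κ ≠ Action.daimon := by rintro rfl; simp [Action.isPositive] at hκ
    rcases h.1.justified [] κ (by simp) hd with h | ⟨_, h, _⟩
    · exact Or.inl h
    · simp at h
  · rcases h.2.2 v' a κ (by simp) hκ with h1 | h1
    · exact Or.inl h1
    · refine Or.inr ⟨v', a, rfl, h1, ?_⟩
      rw [alt_of h.1.alternating List.prefix_rfl, hκ]; rfl

def Par (ξ : Address) (b : Bool) (a : Action) : Prop :=
  ∃ t : List ℕ, a.focus? = some (ξ ++ t) ∧ (a.isPositive = b ↔ Even t.length)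

theorem Par.dual {ξ : Address} {b : Bool} {a : Action} (h : Par ξ b a) :
    Par ξ (!b) a.dual := by
  obtain ⟨t, h1, h2⟩ := h
  refine ⟨t, by rw [focus_dual, h1], ?_⟩
  have : a ≠ Action.daimon := by rintro rfl; simp [Action.focus?] at h1
  rw [dual_isPositive this, ← h2]
  simp

theorem par_neg {ξ : Address} {b : Bool} {X Y : Set (List Action)} {u : List Action}
    {κ : Action} (h : Legal ξ b X Y (u ++ [κ])) (hκ : κ.isPositive = false)
    (ih : ∀ a ∈ u, Par ξ b a) : Par ξ b κ := by
  have hv := (h.2.2.2 _ List.prefix_rfl (by simp)).1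
  obtain ⟨s', hs', e⟩ := view_snoc u κ
  rw [e] at hv
  have hc := h.1.chron _ hv
  rcases neg_just hc hκ with h1 | ⟨v', a, e', hj, ha⟩
  · obtain ⟨I, rfl⟩ := (initial_iff _ _ _).mp h1
    exact ⟨[], by simp [Action.focus?], by simp [Action.isPositive]⟩
  · have hau : a ∈ u := hs'.subset (mem_of_view (by rw [e']; simp))
    obtain ⟨t, h1, h2⟩ := ih a hau
    obtain ⟨f, i, h3, h4⟩ := justifies_focus hj
    rw [h1] at h3
    simp only [Option.some.injEq] at h3
    subst h3
    refine ⟨t ++ [i], by rw [h4, List.append_assoc], ?_⟩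
    rw [ha] at h2
    rw [hκ, List.length_append, List.length_singleton, Nat.even_add_one, ← h2]
    cases b <;> simp

theorem Legal.par {ξ : Address} {b : Bool} {X Y : Set (List Action)} {s : List Action}
    (h : Legal ξ b X Y s) : ∀ a ∈ s, Par ξ b a := by
  induction s using List.reverseRecOn with
  | nil => simp
  | append_singleton u κ ih =>
    have ih := ih (h.pre (List.prefix_append _ _))
    intro a ha
    rcases List.mem_append.mp ha with ha | ha
    · exact ih a ha
    · obtain rfl : a = κ := by simpa using ha
      cases hp : a.isPositive
      · exact par_neg h hp ih
      · have hd : a ≠ Action.daimon := by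
          rintro rfl; exact h.2.2.1 (by simp)
        have hs := h.swap
        rw [List.map_append] at hs
        have := par_neg hs (by rw [dual_isPositive hd, hp]; rfl) (by
          intro x hx
          obtain ⟨y, hy, rfl⟩ := List.mem_map.mp hx
          exact (ih y hy).dual)
        have := this.dual
        rwa [dual_dual, Bool.not_not] at this

theorem fresh_pos {ξ : Address} {b : Bool} {X Y : Set (List Action)} {s : List Action}
    {κ : Action} (h : Legal ξ b X Y (s ++ [κ])) (hlin : (s.filterMap Action.focus?).Nodup)
    (hκ : κ.isPositive = true) {κ' : Action} (hm : κ' ∈ s) {ζ : Address}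
    (f1 : κ.focus? = some ζ) (f2 : κ'.focus? = some ζ) : False := by
  have hκ' : κ'.isPositive = true := by
    obtain ⟨t, e, p⟩ := h.par κ (by simp)
    obtain ⟨t', e', p'⟩ := h.par κ' (by simp [hm])
    rw [f1] at e
    rw [f2] at e'
    have : t = t' := by
      rw [e] at e'
      simpa using e'
    subst this
    rw [hκ, ← p'] at p
    revert p
    cases b <;> cases κ'.isPositive <;> simp
  obtain ⟨s1, s2, rfl⟩ := List.append_of_mem hm
  have hc := (h.2.2.2 _ List.prefix_rfl (by simp)).1
  have hc' := (h.2.2.2 (s1 ++ [κ']) ⟨s2 ++ [κ], by simp⟩ (by simp)).1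
  rw [view_snoc_pos _ _ hκ] at hc
  rw [view_snoc_pos _ _ hκ'] at hc'
  have L := (h.1.chron _ hc).1.linearity
  have L' := (h.1.chron _ hc').1.linearity
  have heq : ¬ view (s1 ++ κ' :: s2) ++ [κ] = view s1 ++ [κ'] := by
    intro e
    have e1 := (List.append_inj' e rfl).1
    rcases snoc_cases s1 with rfl | ⟨u1, z1, rfl⟩
    · rcases snoc_cases ([] ++ κ' :: s2) with h0 | ⟨u, z, h0⟩
      · simp at h0
      · obtain ⟨s', _, ev⟩ := view_snoc u z
        rw [h0, ev] at e1
        simp [view_nil] at e1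
    · rcases snoc_cases (κ' :: s2) with h0 | ⟨u, z, h0⟩
      · simp at h0
      · obtain ⟨s', _, ev⟩ := view_snoc (u1 ++ [z1] ++ u) z
        obtain ⟨s'', _, ev'⟩ := view_snoc u1 z1
        rw [h0, ← List.append_assoc, ev, ev'] at e1
        have hz : z = z1 := by simpa using (List.append_inj' e1 rfl).2
        subst hz
        obtain ⟨t, ft, _⟩ := h.par z (by simp)
        exact foc_disj hlin (x := z) (y := z) (by simp) (by rw [h0]; simp) ft ft
  rcases fork (view (s1 ++ κ' :: s2) ++ [κ]) (view s1 ++ [κ']) with hp | hp | ⟨w, x, y, hxy, hx, hy⟩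
  · rcases prefix_snoc hp with hp | hp
    · exact heq hp
    · exact foc_disj L' (x := κ) (y := κ') (hp.subset (by simp)) (by simp) f1 f2
  · rcases prefix_snoc hp with hp | hp
    · exact heq hp.symm
    · exact foc_disj L (x := κ') (y := κ) (hp.subset (by simp)) (by simp) f2 f1
  · have hco := h.1.coherent _ hc _ hc'
    rcases hco.1 w x y hx hy with e | ⟨nx, ny⟩
    · exact hxy e
    · rcases prefix_snoc hx with e | hx'
      · have : x = κ := by simpa using (List.append_inj' e rfl).2
        rw [this, hκ] at nx; simp at nx
      · rcases prefix_snoc hy with e | hy'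
        · have : y = κ' := by simpa using (List.append_inj' e rfl).2
          rw [this, hκ'] at ny; simp at ny
        · have mx : x ∈ s1 ++ κ' :: s2 := mem_of_view (hx'.subset (by simp))
          have my : y ∈ s1 ++ κ' :: s2 :=
            List.mem_append_left _ (mem_of_view (hy'.subset (by simp)))
          obtain ⟨r, hr⟩ := hx'
          obtain ⟨r', hr'⟩ := hy'
          cases x with
          | daimon => simp [Action.isPositive] at nx
          | proper px ξ₁ I₁ =>
            cases y with
            | daimon => simp [Action.isPositive] at ny
            | proper py ξ₂ I₂ =>
              simp only [Action.isPositive] at nx ny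
              subst nx ny
              by_cases hξ : ξ₁ = ξ₂
              · subst hξ
                exact hxy (foc_inj hlin mx my rfl rfl)
              · refine hco.2 w ξ₁ I₁ r κ ξ₂ I₂ r' κ' ?_ ?_ hξ ζ f1 f2
                · rw [← hr]; simp
                · rw [← hr']; simp

theorem filterMap_dual (s : List Action) :
    (s.map Action.dual).filterMap Action.focus? = s.filterMap Action.focus? := by
  rw [List.filterMap_map]
  congr 1
  funext a
  exact focus_dual a

theorem Legal.lin {ξ : Address} {b : Bool} {X Y : Set (List Action)} {s : List Action}
    (h : Legal ξ b X Y s) : (s.filterMap Action.focus?).Nodup := by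
  induction s using List.reverseRecOn with
  | nil => simp
  | append_singleton u κ ih =>
    have ih := ih (h.pre (List.prefix_append _ _))
    obtain ⟨t, ft, _⟩ := h.par κ (by simp)
    have key : ∀ κ' ∈ u, κ'.focus? = some (ξ ++ t) → False := by
      intro κ' hm f2
      cases hp : κ.isPositive
      · have hd : κ ≠ Action.daimon := by
          rintro rfl; exact h.2.2.1 (by simp)
        have hs := h.swap
        rw [List.map_append] at hs
        exact fresh_pos hs (by rwa [filterMap_dual]) (by rw [dual_isPositive hd, hp]; rfl)
          (List.mem_map_of_mem hm) (by rw [focus_dual, ft]) (by rw [focus_dual, f2])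
      · exact fresh_pos h ih hp hm ft f2
    rw [List.filterMap_append]
    refine List.Nodup.append ih (by simp [ft]) ?_
    intro z hz hz'
    obtain ⟨κ', hm, e⟩ := List.mem_filterMap.mp hz
    simp [ft] at hz'
    exact key κ' hm (by rw [e, hz'])

theorem path_of_legal {ξ : Address} {b : Bool} {X Y : Set (List Action)} {s : List Action}
    (h : Legal ξ b X Y s) {t : List Action}
    (ht : t = s ∨ (t = s ++ [Action.daimon] ∧ view (s ++ [Action.daimon]) ∈ X))
    (hne : b = true → t ≠ []) : PathOf (simpleBase ξ b) X t := by
  have hv : ∀ q, q <+: t → q ≠ [] → view q ∈ X := by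
    intro q hq hq0
    rcases ht with rfl | ⟨rfl, hX⟩
    · exact (h.2.2.2 q hq hq0).1
    · rcases prefix_snoc hq with rfl | hq
      · exact hX
      · exact (h.2.2.2 q hq hq0).1
  have hw : ∀ w a, w ++ [a] <+: t → w <+: s := by
    intro w a hp
    rcases ht with rfl | ⟨rfl, hX⟩
    · exact (List.prefix_append _ _).trans hp
    · rcases prefix_snoc hp with e | hp
      · rw [(List.append_inj' e rfl).1]
      · exact (List.prefix_append _ _).trans hp
  have hwa : ∀ w a, w ++ [a] <+: t → a ≠ Action.daimon → w ++ [a] <+: s := by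
    intro w a hp ha
    rcases ht with rfl | ⟨rfl, hX⟩
    · exact hp
    · rcases prefix_snoc hp with e | hp
      · exact (ha (by simpa using (List.append_inj' e rfl).2)).elim
      · exact hp
  have hlin : (t.filterMap Action.focus?).Nodup := by
    rcases ht with rfl | ⟨rfl, hX⟩
    · exact h.lin
    · have e0 : [Action.daimon].filterMap Action.focus? = [] := rfl
      rw [List.filterMap_append, e0, List.append_nil]
      exact h.lin
  have hjust : ∀ w a, w ++ [a] <+: t → a ≠ Action.daimon →
      Initial (simpleBase ξ b) a ∨ ∃ s', s' <+: w ∧ view (w ++ [a]) = view s' ++ [a] ∧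
        ∃ b ∈ view s', b.justifies a := by
    intro w a hp ha
    have hc := h.1.chron _ (hv _ hp (by simp))
    obtain ⟨s', hs', e⟩ := view_snoc w a
    rw [e] at hc
    rcases hc.1.justified _ a List.prefix_rfl ha with h1 | h1
    · exact Or.inl h1
    · exact Or.inr ⟨s', hs', e, h1⟩
  refine ⟨⟨?_, ?_, ?_, ?_, hlin, ?_, ?_, ?_⟩, hv⟩
  · refine List.isChain_iff_forall_rel_of_append_cons_cons.mpr ?_
    intro a c u l2 e
    have hp : u ++ [a] ++ [c] <+: t := ⟨l2, by rw [e]; simp⟩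
    cases hc : c.isPositive
    · have hcd : c ≠ Action.daimon := by rintro rfl; simp [Action.isPositive] at hc
      have hp' := hwa _ _ hp hcd
      have had : a ≠ Action.daimon := by
        rintro rfl; exact h.2.2.1 (hp'.subset (by simp))
      have hY := (h.2.2.2 _ hp' (by simp)).2
      have hcp : c.dual.isPositive = true := by rw [dual_isPositive hcd, hc]; rfl
      rw [List.map_append, List.map_append] at hY
      simp only [List.map_cons, List.map_nil] at hY
      rw [view_snoc_pos _ _ hcp] at hY
      obtain ⟨s', _, e'⟩ := view_snoc (u.map Action.dual) a.dual
      rw [e'] at hY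
      have := alt_of (h.2.1.chron _ hY).1.alternating List.prefix_rfl
      rw [hcp, dual_isPositive had] at this
      simpa using this
    · have hX := hv _ hp (by simp)
      rw [view_snoc_pos _ _ hc] at hX
      obtain ⟨s', _, e'⟩ := view_snoc u a
      rw [e'] at hX
      have := alt_of (h.1.chron _ hX).1.alternating List.prefix_rfl
      rw [hc] at this
      rw [this]; simp
  · intro w a hp ha
    rcases hjust w a hp ha with h1 | ⟨s', hs', _, c, hc, hj⟩
    · exact Or.inl h1
    · exact Or.inr ⟨c, hs'.subset (mem_of_view hc), hj⟩
  · intro w a c hp ha hcw hj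
    have had : a ≠ Action.daimon := by
      rintro rfl; cases c <;> simp [Action.justifies, Action.justifiesB] at hj
    obtain ⟨f, i, fc, fa⟩ := justifies_focus hj
    have hws := hw w a hp
    rcases hjust w a hp had with h1 | ⟨s', hs', e, c', hc', hj'⟩
    · obtain ⟨I, rfl⟩ := (initial_iff _ _ _).mp h1
      obtain ⟨t', ft, _⟩ := h.par c (hws.subset hcw)
      rw [fc] at ft
      simp only [Option.some.injEq, Action.focus?] at ft fa
      have := congrArg List.length fa
      rw [ft] at this
      simp at this
    · rw [view_snoc_pos _ _ ha] at e
      have e1 := (List.append_inj' e rfl).1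
      obtain ⟨f', i', fc', fa'⟩ := justifies_focus hj'
      rw [fa] at fa'
      simp only [Option.some.injEq] at fa'
      have : f = f' := (List.append_inj' fa' rfl).1
      subst this
      rw [← e1] at hc'
      have := foc_inj h.lin (hws.subset hcw) (hws.subset (mem_of_view hc')) fc fc'
      rw [this]; exact hc'
  · intro w a hp ha had σ hσ hf
    obtain ⟨f, hf1, hf2⟩ := hf
    cases b
    · simp [simpleBase] at hσ
      subst hσ
      simp at hf2
    · simp [simpleBase] at hσ
      subst hσ
      simp at hf2
      subst hf2
      left
      refine ⟨?_, rfl⟩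
      cases w with
      | nil => rfl
      | cons z w' =>
        exfalso
        have hps := hwa _ _ hp had
        have hz := (h.2.2.2 [z] (List.IsPrefix.trans ⟨w' ++ [a], by simp⟩ hps) (by simp)).1
        obtain ⟨s', hs', e⟩ := view_snoc [] z
        rw [List.prefix_nil.mp hs', view_nil] at e
        simp only [List.nil_append] at e
        rw [e] at hz
        have hzd : z ≠ Action.daimon := by
          rintro rfl; exact h.2.2.1 (hps.subset (by simp))
        rcases (h.1.chron _ hz).1.justified [] z (by simp) hzd with h1 | ⟨_, h1, _⟩
        · obtain ⟨I, rfl⟩ := (initial_iff _ _ _).mp h1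
          obtain ⟨r, hr⟩ := hps
          have hl := h.lin
          rw [← hr, List.filterMap_append] at hl
          have hl := hl.of_append_left
          exact foc_disj hl (x := Action.proper true f I) (y := a) (by simp) (by simp) rfl hf1
        · simp at h1
  · intro w hp
    rcases ht with rfl | ⟨rfl, hX⟩
    · exact (h.2.2.1 (hp.subset (by simp))).elim
    · rcases prefix_snoc hp with e | hp
      · exact e
      · exact (h.2.2.1 (hp.subset (by simp))).elim
  · intro hh
    cases t with
    | nil => simp at hh
    | cons z t' =>
      have hz := hv [z] ⟨t', by simp⟩ (by simp)
      obtain ⟨s', hs', e⟩ := view_snoc [] z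
      rw [List.prefix_nil.mp hs', view_nil] at e
      simp only [List.nil_append] at e
      rw [e] at hz
      exact (h.1.chron _ hz).1.daimonFirst (by simpa using hh)
  · intro hb
    cases t with
    | nil => exact (hne ((base_pos_iff _ _).mp hb) rfl).elim
    | cons z t' =>
      have hz := hv [z] ⟨t', by simp⟩ (by simp)
      obtain ⟨s', hs', e⟩ := view_snoc [] z
      rw [List.prefix_nil.mp hs', view_nil] at e
      simp only [List.nil_append] at e
      rw [e] at hz
      obtain ⟨a, t2, e2, h2⟩ := (h.1.chron _ hz).1.totality hb
      simp only [List.cons.injEq] at e2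
      rw [← e2.1] at h2
      exact ⟨z, t', rfl, h2⟩

theorem conv_legal {ξ : Address} {X Y : Set (List Action)} {s : List Action}
    (hc : Conv X Y True s) : Legal ξ true X Y s →
    ∃ s', Legal ξ true X Y s' ∧ (view (s' ++ [Action.daimon]) ∈ X ∨
      (s' ≠ [] ∧ view (s'.map Action.dual ++ [Action.daimon]) ∈ Y)) := by
  have ext : ∀ {s : List Action} {κ : Action}, Legal ξ true X Y s → κ ≠ Action.daimon →
      view (s ++ [κ]) ∈ X → view ((s ++ [κ]).map Action.dual) ∈ Y →
      Legal ξ true X Y (s ++ [κ]) := by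
    intro s κ h hk h1 h2
    refine ⟨h.1, h.2.1, ?_, ?_⟩
    · intro hd
      rcases List.mem_append.mp hd with hd | hd
      · exact h.2.2.1 hd
      · exact hk (List.mem_singleton.mp hd).symm
    · intro q hq hq0
      rcases prefix_snoc hq with rfl | hq
      · exact ⟨h1, h2⟩
      · exact h.2.2.2 q hq hq0
  induction hc with
  | daiD _ h1 => exact fun h => ⟨_, h, Or.inl h1⟩
  | daiR h0 h1 =>
    refine fun h => ⟨_, h, Or.inr ⟨?_, h1⟩⟩
    rintro rfl
    exact h0 trivial
  | stepD _ _ hd h1 h2 _ ih => exact fun h => ih (ext h hd h1 h2)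
  | stepR _ hn h1 h2 _ ih =>
    exact fun h => ih (ext h (by rintro rfl; simp [Action.isPositive] at hn) h2 h1)

theorem conv_path {ξ : Address} {X Y : Set (List Action)}
    (hX : IsDesign (simpleBase ξ true) X) (hY : IsDesign (simpleBase ξ false) Y)
    (hc : Conv X Y True []) :
    ∃ p, PathOf (simpleBase ξ true) X p ∧ PathOf (simpleBase ξ false) Y (dualSeq p) := by
  obtain ⟨s, hs, h⟩ := conv_legal (ξ := ξ) hc ⟨hX, hY, by simp, by
    intro q hq hq0
    exact (hq0 (List.prefix_nil.mp hq)).elim⟩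
  rcases h with h | ⟨h0, h⟩
  · refine ⟨s ++ [Action.daimon], path_of_legal hs (Or.inr ⟨rfl, h⟩) (by simp), ?_⟩
    rw [dualSeq_snoc]
    exact path_of_legal hs.swap (Or.inl rfl) (by simp)
  · refine ⟨s, path_of_legal hs (Or.inl rfl) (fun _ => h0), ?_⟩
    rw [dualSeq_nodai hs.2.2.1]
    exact path_of_legal hs.swap (Or.inr ⟨rfl, h⟩) (by simp)

theorem main_trace {ξ : Address} {b : Bool} {X Y : Set (List Action)}
    (hX : IsDesign (simpleBase ξ b) X) (hY : IsDesign (simpleBase ξ !b) Y)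
    (hc : if b then Conv X Y True [] else Conv Y X True []) :
    ∃ p, PathOf (simpleBase ξ b) X p ∧ PathOf (simpleBase ξ !b) Y (dualSeq p) := by
  cases b
  · simp only [Bool.false_eq_true, if_false] at hc
    obtain ⟨p, h1, h2⟩ := conv_path hY hX hc
    exact ⟨dualSeq p, h2, by rw [dualSeq_dualSeq h1.1]; exact h1⟩
  · simp only [if_true] at hc
    exact conv_path hX hY hc

/-- Paths of dual pairs are positive-ended. -/
theorem last_pos {β β' : Base} {p : List Action} {u : List Action} {a : Action}
    (h2 : IsPath β' (dualSeq p)) (e : p = u ++ [a]) (hp : IsPath β p) :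
    a.isPositive = true := by
  obtain ⟨s, hs, h | h⟩ := path_split hp
  · subst h
    rw [dualSeq_nodai hs, e, List.map_append] at h2
    have := alt_of h2.alternating (List.prefix_rfl)
    have ha : a ≠ Action.daimon := by rintro rfl; exact hs (by rw [e]; simp)
    rw [dual_isPositive ha] at this
    simpa [Action.isPositive] using this
  · rw [h] at e
    have : Action.daimon = a := by simpa using (List.append_inj' e rfl).2
    rw [← this]; rfl

theorem path_conv {ξ : Address} {X Y : Set (List Action)} {p : List Action}
    (hX : PathOf (simpleBase ξ true) X p) (hY : PathOf (simpleBase ξ false) Y (dualSeq p)) :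
    Conv X Y True [] := by
  have turn : ∀ u κ, u ++ [κ] <+: p → (TurnD True u ↔ κ.isPositive = true) := by
    intro u κ hp
    rcases snoc_cases u with rfl | ⟨u, a, rfl⟩
    · obtain ⟨t, ht⟩ := hp
      have := head_pol hX.1 (a := κ) (t := t) (by rw [← ht]; simp)
      simp [TurnD, this]
    · have := alt_of hX.1.alternating hp
      simp [TurnD, this]
  have back : ∀ s : List Action, Action.daimon ∉ s → s <+: p →
      s.map Action.dual <+: dualSeq p → Conv X Y True s → Conv X Y True [] := by
    intro s
    induction s using List.reverseRecOn with
    | nil => exact fun _ _ _ h => h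
    | append_singleton u κ ih =>
      intro hd hp hq hc
      have hk : κ ≠ Action.daimon := by rintro rfl; exact hd (by simp)
      have hx := hX.2 _ hp (by simp)
      have hy := hY.2 _ hq (by simp)
      refine ih (fun h => hd (by simp [h])) ((List.prefix_append _ _).trans hp)
        (((List.prefix_append u [κ]).map Action.dual).trans hq) ?_
      have ht := turn u κ hp
      cases hpol : κ.isPositive
      · exact Conv.stepR (by rw [ht, hpol]; simp) hpol hy hx hc
      · exact Conv.stepD (by rw [ht, hpol]) hpol hk hx hy hc
  obtain ⟨s, hs, h | h⟩ := path_split hX.1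
  · subst h
    have e := dualSeq_nodai hs
    refine back p hs List.prefix_rfl (by rw [e]; exact List.prefix_append _ _) ?_
    refine Conv.daiR ?_ ?_
    · rcases snoc_cases p with h0 | ⟨u, a, h0⟩
      · obtain ⟨a, t, h1, _⟩ := hX.1.totality ((base_pos_iff _ _).mpr rfl)
        rw [h0] at h1; simp at h1
      · have := last_pos hY.1 h0 hX.1
        rw [h0]; simp [TurnD, this]
    · rw [← e]; exact hY.2 _ List.prefix_rfl (by rw [e]; simp)
  · subst h
    have e := dualSeq_snoc s
    refine back s hs (List.prefix_append _ _) (by rw [e]) ?_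
    exact Conv.daiD (by rw [turn _ _ List.prefix_rfl]; rfl) (hX.2 _ List.prefix_rfl (by simp))

theorem main_conv {ξ : Address} {b : Bool} {X Y : Set (List Action)} {p : List Action}
    (hX : PathOf (simpleBase ξ b) X p) (hY : PathOf (simpleBase ξ !b) Y (dualSeq p)) :
    if b then Conv X Y True [] else Conv Y X True [] := by
  cases b
  · simp only [Bool.false_eq_true, if_false]
    exact path_conv hY (by rw [dualSeq_dualSeq hX.1]; exact hX)
  · simp only [if_true]
    exact path_conv hX hY

theorem design_det {β : Base} {X : Set (List Action)} (h : IsDesign β X) {w : List Action}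
    {x y : Action} (hx : view (w ++ [x]) ∈ X) (hy : view (w ++ [y]) ∈ X)
    (px : x.isPositive = true) (py : y.isPositive = true) : x = y := by
  rw [view_snoc_pos _ _ px] at hx
  rw [view_snoc_pos _ _ py] at hy
  rcases (h.coherent _ hx _ hy).1 _ x y List.prefix_rfl List.prefix_rfl with h | h
  · exact h
  · rw [px] at h; simp at h

theorem dual_prefix {β : Base} {p w : List Action} {x : Action} (hp : IsPath β p)
    (h : w ++ [x] <+: p) (hx : x ≠ Action.daimon) :
    w.map Action.dual ++ [x.dual] <+: dualSeq p := by
  obtain ⟨s, hs, e | e⟩ := path_split hp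
  · subst e
    rw [dualSeq_nodai hs]
    exact (by simpa using h.map Action.dual : w.map Action.dual ++ [x.dual] <+: _).trans
      (List.prefix_append _ _)
  · subst e
    rw [dualSeq_snoc]
    rcases prefix_snoc h with e | h
    · exact (hx (by simpa using (List.append_inj' e rfl).2)).elim
    · simpa using h.map Action.dual

theorem not_proper {ξ : Address} {b : Bool} {X Y : Set (List Action)} {p p' : List Action}
    (hY : IsDesign (simpleBase ξ !b) Y)
    (h1 : PathOf (simpleBase ξ b) X p) (h2 : PathOf (simpleBase ξ !b) Y (dualSeq p))
    (h1' : PathOf (simpleBase ξ b) X p') (h2' : PathOf (simpleBase ξ !b) Y (dualSeq p'))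
    (h : p <+: p') : p = p' := by
  obtain ⟨t, ht⟩ := h
  cases t with
  | nil => simpa using ht
  | cons x t =>
    exfalso
    have hpx : p ++ [x] <+: p' := ⟨t, by rw [← ht]; simp⟩
    have hx : x.isPositive = false := by
      rcases snoc_cases p with e | ⟨u, a, e⟩
      · have hb := head_pol h1'.1 (a := x) (t := t) (by rw [← ht, e]; simp)
        cases b
        · exact hb
        · obtain ⟨_, _, h, _⟩ := h1.1.totality ((base_pos_iff _ _).mpr rfl)
          rw [e] at h; simp at h
      · have ha := last_pos h2.1 e h1.1
        rw [e] at hpx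
        have := alt_of h1'.1.alternating hpx
        rw [ha] at this
        simpa using this.symm
    have hxd : x ≠ Action.daimon := by rintro rfl; simp [Action.isPositive] at hx
    have hd : Action.daimon ∉ p := by
      intro hd
      obtain ⟨w, r, e⟩ := List.append_of_mem hd
      have := h1'.1.daimonLast w ⟨r ++ x :: t, by rw [← ht, e]; simp⟩
      have := congrArg List.length this
      rw [← ht, e] at this
      simp at this
    have hdx := h2'.2 _ (dual_prefix h1'.1 hpx hxd) (by simp)
    have hdd := h2.2 _ List.prefix_rfl (by rw [dualSeq_nodai hd]; simp)
    rw [dualSeq_nodai hd] at hdd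
    have := design_det hY hdx hdd (by rw [dual_isPositive hxd, hx]; rfl) rfl
    exact hxd (dual_eq_daimon.mp this)

theorem trace_unique {ξ : Address} {b : Bool} {X Y : Set (List Action)} {p p' : List Action}
    (hX : IsDesign (simpleBase ξ b) X) (hY : IsDesign (simpleBase ξ !b) Y)
    (h1 : PathOf (simpleBase ξ b) X p) (h2 : PathOf (simpleBase ξ !b) Y (dualSeq p))
    (h1' : PathOf (simpleBase ξ b) X p') (h2' : PathOf (simpleBase ξ !b) Y (dualSeq p')) :
    p = p' := by
  rcases fork p p' with h | h | ⟨w, x, y, hxy, hx, hy⟩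
  · exact not_proper hY h1 h2 h1' h2' h
  · exact (not_proper hY h1' h2' h1 h2 h).symm
  · exfalso
    have pol : x.isPositive = y.isPositive := by
      rcases snoc_cases w with rfl | ⟨u, a, rfl⟩
      · obtain ⟨t, ht⟩ := hx
        obtain ⟨t', ht'⟩ := hy
        rw [head_pol h1.1 (a := x) (t := t) (by rw [← ht]; simp),
          head_pol h1'.1 (a := y) (t := t') (by rw [← ht']; simp)]
      · have e1 := alt_of h1.1.alternating hx
        have e2 := alt_of h1'.1.alternating hy
        rw [e1] at e2
        simpa using e2
    cases hp : x.isPositive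
    · have hq : y.isPositive = false := by rw [← pol, hp]
      have hxd : x ≠ Action.daimon := by rintro rfl; simp [Action.isPositive] at hp
      have hyd : y ≠ Action.daimon := by rintro rfl; simp [Action.isPositive] at hq
      exact hxy (dual_inj (design_det hY (h2.2 _ (dual_prefix h1.1 hx hxd) (by simp))
        (h2'.2 _ (dual_prefix h1'.1 hy hyd) (by simp))
        (by rw [dual_isPositive hxd, hp]; rfl) (by rw [dual_isPositive hyd, hq]; rfl)))
    · exact hxy (design_det hX (h1.2 _ hx (by simp)) (h1'.2 _ hy (by simp)) hp
        (by rw [← pol, hp]))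

def negDai (ξ : Address) : Set (List Action) :=
  {c | ∃ I, c = [Action.proper false ξ I] ∨ c = [Action.proper false ξ I, Action.daimon]}

theorem two_prefix {n a : Action} {t w : List Action} (ht : t = [n] ∨ t = [n, Action.daimon])
    (h : w ++ [a] <+: t) : (w = [] ∧ a = n) ∨ (w = [n] ∧ a = Action.daimon ∧ t = w ++ [a]) := by
  have h1 : w ++ [a] <+: [n] → w = [] ∧ a = n := by
    intro h
    rcases prefix_snoc (u := []) (by simpa using h) with h | h
    · have := List.append_inj' h rfl
      exact ⟨this.1, by simpa using this.2⟩
    · simp at h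
  rcases ht with rfl | rfl
  · exact Or.inl (h1 h)
  · rcases prefix_snoc (u := [n]) (by simpa using h) with h | h
    · have := List.append_inj' h rfl
      exact Or.inr ⟨this.1, by simpa using this.2, by rw [h]; rfl⟩
    · exact Or.inl (h1 h)

theorem negDai_chron (ξ : Address) (I : Finset ℕ) {t : List Action}
    (ht : t = [Action.proper false ξ I] ∨ t = [Action.proper false ξ I, Action.daimon]) :
    IsChronicle (simpleBase ξ false) t := by
  have hin : Initial (simpleBase ξ false) (Action.proper false ξ I) :=
    (initial_iff _ _ _).mpr ⟨I, rfl⟩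
  refine ⟨⟨?_, ?_, ?_, ?_, ?_, ?_, ?_, ?_⟩, ?_, ?_⟩
  · rcases ht with rfl | rfl
    · exact List.isChain_singleton _
    · exact List.isChain_pair.mpr (by simp [Action.isPositive])
  · intro w a hp ha
    rcases two_prefix ht hp with ⟨rfl, rfl⟩ | ⟨rfl, rfl, _⟩
    · exact Or.inl hin
    · exact (ha rfl).elim
  · intro w a b hp ha hb hj
    rcases two_prefix ht hp with ⟨rfl, rfl⟩ | ⟨rfl, rfl, _⟩
    · simp at hb
    · cases b <;> simp [Action.justifies, Action.justifiesB] at hj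
  · intro w a hp ha had
    rcases two_prefix ht hp with ⟨rfl, rfl⟩ | ⟨rfl, rfl, _⟩
    · simp [Action.isPositive] at ha
    · exact (had rfl).elim
  · rcases ht with rfl | rfl <;> simp [List.filterMap_cons, Action.focus?]
  · intro w hp
    rcases two_prefix ht hp with ⟨_, h⟩ | ⟨_, _, h⟩
    · cases h
    · exact h.symm
  · intro h
    rcases ht with rfl | rfl <;> simp at h
  · intro h
    simp [base_pos_iff] at h
  · rcases ht with rfl | rfl <;> simp
  · intro w a b hp hb
    rcases two_prefix (w := w ++ [a]) (a := b) ht (by simpa using hp) with ⟨_, rfl⟩ | ⟨_, rfl, _⟩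
    · exact Or.inl hin
    · simp [Action.isPositive] at hb

theorem negDai_design (ξ : Address) : IsDesign (simpleBase ξ false) (negDai ξ) := by
  refine ⟨?_, ?_, ?_, ?_, ?_⟩
  · rintro c ⟨I, hc⟩
    exact negDai_chron ξ I hc
  · rintro c ⟨I, hc⟩ d hd hd0
    rcases snoc_cases d with rfl | ⟨w, a, rfl⟩
    · exact (hd0 rfl).elim
    · rcases two_prefix hc hd with ⟨rfl, rfl⟩ | ⟨rfl, rfl, _⟩
      · exact ⟨I, Or.inl rfl⟩
      · exact ⟨I, Or.inr rfl⟩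
  · rintro c ⟨I, hc⟩ d ⟨J, hd⟩
    refine ⟨?_, ?_⟩
    · intro w κ₁ κ₂ h1 h2
      rcases two_prefix hc h1 with ⟨rfl, rfl⟩ | ⟨rfl, rfl, _⟩
      · rcases two_prefix hd h2 with ⟨_, rfl⟩ | ⟨h, rfl, _⟩
        · exact Or.inr ⟨rfl, rfl⟩
        · simp at h
      · rcases two_prefix hd h2 with ⟨h, rfl⟩ | ⟨h, rfl, _⟩
        · simp at h
        · exact Or.inl rfl
    · intro w ξ₁ I₁ w₁ σ₁ ξ₂ I₂ w₂ σ₂ h1 h2 hne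
      have m1 := h1.subset (a := Action.proper false ξ₁ I₁) (by simp)
      have m2 := h2.subset (a := Action.proper false ξ₂ I₂) (by simp)
      have e1 : ξ₁ = ξ := by
        rcases hc with rfl | rfl <;> simp at m1 <;> exact m1.1
      have e2 : ξ₂ = ξ := by
        rcases hd with rfl | rfl <;> simp at m2 <;> exact m2.1
      exact (hne (by rw [e1, e2])).elim
  · rintro c ⟨I, rfl | rfl⟩ hmax
    · exact (hmax Action.daimon ⟨I, Or.inr rfl⟩).elim
    · exact ⟨Action.daimon, by simp, rfl⟩
  · intro h
    simp [base_pos_iff] at h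

theorem view_single (z : Action) : view [z] = [z] := by
  obtain ⟨s', hs', e⟩ := view_snoc [] z
  rw [List.prefix_nil.mp hs', view_nil] at e
  simpa using e

theorem negDai_orth {ξ : Address} (A : Behaviour ξ true) :
    negDai ξ ∈ orthSet ξ true A.designs := by
  refine ⟨negDai_design ξ, ?_⟩
  intro D hD
  simp only [if_true]
  have hd := A.isDesign D hD
  have hb := (base_pos_iff ξ true).mpr rfl
  obtain ⟨c, hc⟩ := hd.posNonempty hb
  obtain ⟨a, t, e, h⟩ := (hd.chron c hc).1.totality hb
  have ha : [a] ∈ D := hd.prefixClosed c hc _ ⟨t, by rw [e]; simp⟩ (by simp)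
  have ht : TurnD True [] := trivial
  rcases h with rfl | ⟨hp, hi⟩
  · exact Conv.daiD ht (by simpa [view_single] using ha)
  · obtain ⟨I, rfl⟩ := (initial_iff _ _ _).mp hi
    refine Conv.stepD (κ := Action.proper true ξ I) ht rfl (by simp)
      (by simpa [view_single] using ha) ?_ ?_
    · exact ⟨I, Or.inl (by simp [view_single, Action.dual])⟩
    · refine Conv.daiR (by simp [TurnD, Action.isPositive]) ⟨I, Or.inr ?_⟩
      rw [view_snoc_pos _ _ rfl]
      simp [view_single, Action.dual]


/-- the incarnation `|D|_A` of a design `D` of a behaviour `A`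
(the minimal design of `A` included in `D`) equals the union over the
counter-designs `E ∈ A⊥` of the chronicles of `D` visited during the
normalization of `(D, E)`. -/
theorem incarnation_eq_union_traces (ξ : Address) (pos : Bool)
    (A : Behaviour ξ pos) (D : Set (List Action)) (hD : D ∈ A.designs) :
    ({c | ∃ E ∈ orthSet ξ pos A.designs, ∃ p,
        PathOf (simpleBase ξ pos) D p ∧
        PathOf (simpleBase ξ !pos) E (dualSeq p) ∧
        ∃ q, q <+: p ∧ q ≠ [] ∧ c = view q} : Set (List Action)) ∈ A.designs ∧
    {c | ∃ E ∈ orthSet ξ pos A.designs, ∃ p,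
        PathOf (simpleBase ξ pos) D p ∧
        PathOf (simpleBase ξ !pos) E (dualSeq p) ∧
        ∃ q, q <+: p ∧ q ≠ [] ∧ c = view q} ⊆ D ∧
    ∀ E ∈ A.designs, E ⊆ D →
      {c | ∃ E' ∈ orthSet ξ pos A.designs, ∃ p,
        PathOf (simpleBase ξ pos) D p ∧
        PathOf (simpleBase ξ !pos) E' (dualSeq p) ∧
        ∃ q, q <+: p ∧ q ≠ [] ∧ c = view q} ⊆ E := by
  have hDd := A.isDesign D hD
  have hE : ∀ E ∈ orthSet ξ pos A.designs, ∀ D' ∈ A.designs, ∃ p,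
      PathOf (simpleBase ξ pos) D' p ∧ PathOf (simpleBase ξ !pos) E (dualSeq p) := by
    intro E hE D' hD'
    exact main_trace (A.isDesign D' hD') hE.1 (hE.2 D' hD')
  have hsub : {c | ∃ E ∈ orthSet ξ pos A.designs, ∃ p,
        PathOf (simpleBase ξ pos) D p ∧
        PathOf (simpleBase ξ !pos) E (dualSeq p) ∧
        ∃ q, q <+: p ∧ q ≠ [] ∧ c = view q} ⊆ D := by
    rintro c ⟨E, _, p, h1, _, q, hq, hq0, rfl⟩
    exact h1.2 q hq hq0
  refine ⟨?_, hsub, ?_⟩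
  · have hcl : ∀ S, S ∈ biorth ξ pos A.designs → S ∈ A.designs := by
      intro S hS
      rw [A.closed]
      exact hS
    refine hcl _ ⟨?_, ?_⟩
    · rw [Bool.not_not]
      refine ⟨fun c hc => hDd.chron c (hsub hc), ?_,
        fun c hc d hd => hDd.coherent c (hsub hc) d (hsub hd), ?_, ?_⟩
      · rintro c ⟨E, hEm, p, h1, h2, q, hq, hq0, rfl⟩ d hd hd0
        obtain ⟨q', hq', rfl⟩ := view_prefix _ q d le_rfl hd
        refine ⟨E, hEm, p, h1, h2, q', hq'.trans hq, ?_, rfl⟩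
        rintro rfl
        exact hd0 view_nil
      · rintro c ⟨E, hEm, p, h1, h2, q, hq, hq0, rfl⟩ hmax
        rcases snoc_cases q with rfl | ⟨u, a, rfl⟩
        · exact (hq0 rfl).elim
        · obtain ⟨s', _, e⟩ := view_snoc u a
          refine ⟨a, by rw [e]; simp, ?_⟩
          obtain ⟨t, ht⟩ := hq
          cases t with
          | nil => exact last_pos (u := u) h2.1 (by rw [← ht]; simp) h1.1
          | cons κ t =>
            have hp : u ++ [a] ++ [κ] <+: p := ⟨t, by rw [← ht]; simp⟩
            have hal := alt_of h1.1.alternating hp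
            cases hk : κ.isPositive
            · rw [hal, hk]; rfl
            · exact (hmax κ ⟨E, hEm, p, h1, h2, u ++ [a] ++ [κ], hp, by simp,
                (view_snoc_pos _ _ hk).symm⟩).elim
      · intro hb
        have hb := (base_pos_iff _ _).mp hb
        subst hb
        obtain ⟨p, h1, h2⟩ := hE _ (negDai_orth A) D hD
        obtain ⟨a, t, e, _⟩ := h1.1.totality ((base_pos_iff _ _).mpr rfl)
        exact ⟨_, _, negDai_orth A, p, h1, h2, p, List.prefix_rfl, by rw [e]; simp, rfl⟩
    · intro E hEm
      obtain ⟨p, h1, h2⟩ := hE E hEm D hD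
      have h1' : PathOf (simpleBase ξ pos) {c | ∃ E ∈ orthSet ξ pos A.designs, ∃ p,
          PathOf (simpleBase ξ pos) D p ∧
          PathOf (simpleBase ξ !pos) E (dualSeq p) ∧
          ∃ q, q <+: p ∧ q ≠ [] ∧ c = view q} p :=
        ⟨h1.1, fun q hq hq0 => ⟨E, hEm, p, h1, h2, q, hq, hq0, rfl⟩⟩
      have := main_conv h1' h2
      cases pos
      · simpa using this
      · simpa using this
  · rintro G hG hGD c ⟨E, hEm, p, h1, h2, q, hq, hq0, rfl⟩
    obtain ⟨p', h1', h2'⟩ := hE E hEm G hG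
    have h1D : PathOf (simpleBase ξ pos) D p' := ⟨h1'.1, fun q hq hq0 => hGD (h1'.2 q hq hq0)⟩
    have := trace_unique hDd hEm.1 h1 h2 h1D h2'
    subst this
    exact h1'.2 q hq hq0


end Ludics
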